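/- For every real α with 0 < α < 1 there exist K = K(α) and n₀ = n₀(α) such that every graph with n ≥ n₀ vertices and at least n^{1+α} edges contains a K-almost-regular subgraph on some number m of vertices with m ≥ n^{α(1−α)/(1+α)} and with at least (2/5)·m^{1+α} edges. -/

import Mathlib

variable {V : Type*}

/-- `G` is a bipartite graph with parts `A` and `B`: the parts are disjoint, cover all
vertices, and every edge goes between `A` and `B`. -/
def BipartiteWith (G : SimpleGraph V) (A B : Set V) : Prop :=
  Disjoint A B ∧ A ∪ B = Set.univ ∧
    ∀ ⦃u v : V⦄, G.Adj u v → (u ∈ A ∧ v ∈ B) ∨ (u ∈ B ∧ v ∈ A)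

/-- `G` contains no complete bipartite subgraph `K_{k,k}`. -/
def KkkFree (G : SimpleGraph V) (k : ℕ) : Prop :=
  ¬ ∃ (S T : Finset V), Disjoint S T ∧ S.card = k ∧ T.card = k ∧
      ∀ u ∈ S, ∀ v ∈ T, G.Adj u v

/-- The number of edges of `G`. -/
noncomputable def edgeCount (G : SimpleGraph V) : ℕ := G.edgeSet.ncard

/-- The degree of `v` in `G`. -/
noncomputable def deg (G : SimpleGraph V) (v : V) : ℕ := (G.neighborSet v).ncard

/-- The codegree of `u` and `u'` in `G`: the number of their common neighbours. -/
noncomputable def codeg (G : SimpleGraph V) (u u' : V) : ℕ :=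
  (G.neighborSet u ∩ G.neighborSet u').ncard

/-- The average degree of `G`, as a real number. -/
noncomputable def avgDeg [Fintype V] (G : SimpleGraph V) : ℝ :=
  2 * (edgeCount G : ℝ) / (Fintype.card V : ℝ)

/-- The number of edges of a subgraph. -/
noncomputable def subEdgeCount {G : SimpleGraph V} (H : G.Subgraph) : ℕ := H.edgeSet.ncard

/-- The degree of a vertex in a subgraph. -/
noncomputable def subDeg {G : SimpleGraph V} (H : G.Subgraph) (v : V) : ℕ :=
  (H.neighborSet v).ncard

/-- The average degree of a subgraph. -/
noncomputable def subAvgDeg {G : SimpleGraph V} (H : G.Subgraph) : ℝ :=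
  2 * (subEdgeCount H : ℝ) / (H.verts.ncard : ℝ)

/-- A subgraph `H` is `K`-almost-regular: its maximum degree is at most `K` times its
minimum degree. -/
def SubAlmostRegular {G : SimpleGraph V} (H : G.Subgraph) (K : ℝ) : Prop :=
  ∀ v ∈ H.verts, ∀ w ∈ H.verts, (subDeg H v : ℝ) ≤ K * (subDeg H w : ℝ)

/-- `G` has a nonempty `k`-regular subgraph. -/
def HasRegularSubgraph (G : SimpleGraph V) (k : ℕ) : Prop :=
  ∃ H : G.Subgraph, H.verts.Nonempty ∧ ∀ v ∈ H.verts, subDeg H v = k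

/-- `G` has a nonempty `K`-almost-regular subgraph with average degree at least `c`. -/
def HasAlmostRegularSubgraph (G : SimpleGraph V) (K : ℝ) (c : ℝ) : Prop :=
  ∃ H : G.Subgraph, H.verts.Nonempty ∧ SubAlmostRegular H K ∧ c ≤ subAvgDeg H

/-- `G` is `(L, d)`-almost-biregular with parts `A` and `B`. -/
def IsAlmostBiregular (G : SimpleGraph V) (A B : Set V) (L : ℝ) (d : ℕ) : Prop :=
  BipartiteWith G A B ∧ A.Nonempty ∧
    (∀ v ∈ B, deg G v = d) ∧
    (d : ℝ) ≤ (edgeCount G : ℝ) / (A.ncard : ℝ) ∧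
    ∀ u ∈ A, (deg G u : ℝ) ≤ L * ((edgeCount G : ℝ) / (A.ncard : ℝ))

/-- A subgraph `H` of `G` is `(L, d)`-almost-biregular with parts `A` and `B`. -/
def SubIsAlmostBiregular {G : SimpleGraph V} (H : G.Subgraph) (A B : Set V)
    (L : ℝ) (d : ℕ) : Prop :=
  Disjoint A B ∧ A ∪ B = H.verts ∧
    (∀ ⦃u v : V⦄, H.Adj u v → (u ∈ A ∧ v ∈ B) ∨ (u ∈ B ∧ v ∈ A)) ∧
    A.Nonempty ∧
    (∀ v ∈ B, subDeg H v = d) ∧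
    (d : ℝ) ≤ (subEdgeCount H : ℝ) / (A.ncard : ℝ) ∧
    ∀ u ∈ A, (subDeg H u : ℝ) ≤ L * ((subEdgeCount H : ℝ) / (A.ncard : ℝ))

open Finset Classical in
/-- The number of neighbours of `v` lying in `X`. -/
noncomputable def degIn (G : SimpleGraph V) (X : Finset V) (v : V) : ℕ :=
  #{w ∈ X | G.Adj v w}

open Finset in
/-- The number of ordered pairs of adjacent vertices in `X`, which is twice the number of edges
inside `X`. -/
noncomputable def pairCount (G : SimpleGraph V) (X : Finset V) : ℕ := ∑ v ∈ X, degIn G X v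

open Finset Classical in
lemma pairCount_eq_card (G : SimpleGraph V) (X : Finset V) :
    pairCount G X = #{q ∈ X ×ˢ X | G.Adj q.1 q.2} := by
  simp only [pairCount, degIn, card_filter, sum_product]

open Finset in
lemma pairCount_le_sq (G : SimpleGraph V) (X : Finset V) : pairCount G X ≤ #X ^ 2 := by
  classical
  rw [pairCount_eq_card, sq, ← card_product]
  exact card_filter_le _ _

open Finset in
lemma pairCount_le_erase [DecidableEq V] (G : SimpleGraph V) (X : Finset V) (v : V) :
    pairCount G X ≤ pairCount G (X.erase v) + 2 * degIn G X v := by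
  classical
  have hsub : ({q ∈ X ×ˢ X | G.Adj q.1 q.2} : Finset (V × V)) ⊆
      ({q ∈ X.erase v ×ˢ X.erase v | G.Adj q.1 q.2} : Finset (V × V)) ∪
        (({w ∈ X | G.Adj v w} : Finset V).image (fun w => (v, w)) ∪
         ({w ∈ X | G.Adj v w} : Finset V).image (fun w => (w, v))) := by
    rintro ⟨a, b⟩ h
    simp only [mem_filter, mem_product, mem_union, mem_erase, mem_image, Prod.mk.injEq] at h ⊢
    by_cases ha : a = v
    · subst ha
      exact Or.inr (Or.inl ⟨b, ⟨h.1.2, h.2⟩, rfl, rfl⟩)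
    by_cases hb : b = v
    · subst hb
      exact Or.inr (Or.inr ⟨a, ⟨h.1.1, h.2.symm⟩, rfl, rfl⟩)
    exact Or.inl ⟨⟨⟨ha, h.1.1⟩, hb, h.1.2⟩, h.2⟩
  rw [pairCount_eq_card, pairCount_eq_card]
  refine (card_le_card hsub).trans ((card_union_le _ _).trans ?_)
  refine Nat.add_le_add_left ((card_union_le _ _).trans ?_) _
  rw [two_mul]
  convert Nat.add_le_add card_image_le card_image_le <;> rfl

open Finset in
lemma pairCount_le_sdiff_add_sum [DecidableEq V] (G : SimpleGraph V) {S : Finset V} (A : Finset V)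
    (P : Finpartition S) :
    pairCount G S ≤ pairCount G (S \ A) + ∑ B ∈ P.parts, pairCount G (A ∪ B) := by
  classical
  have hsub : ({q ∈ S ×ˢ S | G.Adj q.1 q.2} : Finset (V × V)) ⊆
      ({q ∈ (S \ A) ×ˢ (S \ A) | G.Adj q.1 q.2} : Finset (V × V)) ∪
        P.parts.biUnion (fun B =>
          ({q ∈ (A ∪ B) ×ˢ (A ∪ B) | G.Adj q.1 q.2} : Finset (V × V))) := by
    rintro ⟨a, b⟩ h
    simp only [mem_filter, mem_product, mem_union, mem_sdiff, mem_biUnion] at h ⊢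
    by_cases ha : a ∈ A
    · obtain ⟨B, hB, hbB⟩ := P.exists_mem h.1.2
      exact Or.inr ⟨B, hB, ⟨Or.inl ha, Or.inr hbB⟩, h.2⟩
    by_cases hb : b ∈ A
    · obtain ⟨B, hB, haB⟩ := P.exists_mem h.1.1
      exact Or.inr ⟨B, hB, ⟨Or.inr haB, Or.inl hb⟩, h.2⟩
    exact Or.inl ⟨⟨⟨h.1.1, ha⟩, h.1.2, hb⟩, h.2⟩
  simp only [pairCount_eq_card]
  exact (card_le_card hsub).trans ((card_union_le _ _).trans
    (Nat.add_le_add_left card_biUnion_le _))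

lemma degIn_mono (G : SimpleGraph V) {X Y : Finset V} (h : X ⊆ Y) (v : V) :
    degIn G X v ≤ degIn G Y v := by
  classical
  exact Finset.card_le_card (Finset.filter_subset_filter _ h)

open Finset in
lemma sum_ncard_neighborSet [Fintype V] (G : SimpleGraph V) :
    ∑ v, (G.neighborSet v).ncard = 2 * edgeCount G := by
  classical
  have := G.sum_degrees_eq_twice_card_edges
  rw [edgeCount, ← SimpleGraph.coe_edgeFinset, Set.ncard_coe_finset, ← this]
  refine sum_congr rfl fun v _ => ?_
  rw [← SimpleGraph.card_neighborFinset_eq_degree, ← Set.ncard_coe_finset,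
    SimpleGraph.coe_neighborFinset]

open Finset in
lemma pairCount_univ [Fintype V] (G : SimpleGraph V) :
    pairCount G univ = 2 * edgeCount G := by
  classical
  rw [← sum_ncard_neighborSet, pairCount]
  refine sum_congr rfl fun v _ => ?_
  rw [degIn, ← Set.ncard_coe_finset]
  congr 1
  ext w
  simp

lemma subDeg_induce_top (G : SimpleGraph V) {T : Finset V} {v : V} (hv : v ∈ T) :
    subDeg ((⊤ : G.Subgraph).induce (T : Set V)) v = degIn G T v := by
  classical
  rw [subDeg, degIn, ← Set.ncard_coe_finset]
  congr 1
  ext w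
  simp [hv]

open Finset in
lemma pairCount_eq_two_mul_subEdgeCount [Fintype V] (G : SimpleGraph V) (T : Finset V) :
    pairCount G T = 2 * subEdgeCount ((⊤ : G.Subgraph).induce (T : Set V)) := by
  classical
  set H := (⊤ : G.Subgraph).induce (T : Set V) with hH
  have h := sum_ncard_neighborSet H.spanningCoe
  have h2 : edgeCount H.spanningCoe = subEdgeCount H := by
    rw [edgeCount, SimpleGraph.Subgraph.edgeSet_spanningCoe, subEdgeCount]
  rw [← h2, ← h, pairCount, ← sum_subset (subset_univ T)]
  · refine sum_congr rfl fun v hv => ?_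
    rw [← subDeg_induce_top G hv]
    rfl
  · intro v _ hv
    rw [Set.ncard_eq_zero]
    ext w
    simp [hH, hv]

open Finset in
/-- A nonempty set `S` maximizing the ratio of `pairCount G S` to `#S ^ β`. -/
lemma exists_max_pairCount_ratio [Fintype V] [Nonempty V] (G : SimpleGraph V) {β : ℝ}
    (hβ : 0 < β) :
    ∃ S : Finset V, S.Nonempty ∧ ∀ X : Finset V,
      (pairCount G X : ℝ) ≤ pairCount G S / (#S : ℝ) ^ β * (#X : ℝ) ^ β := by
  classical
  obtain ⟨S, hS, hmax⟩ := exists_max_image ({X | X.Nonempty} : Finset (Finset V))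
    (fun X => (pairCount G X : ℝ) / (#X : ℝ) ^ β) ⟨univ, by simp⟩
  refine ⟨S, by simpa using hS, fun X => ?_⟩
  rcases X.eq_empty_or_nonempty with rfl | hX
  · simp [pairCount, Real.zero_rpow hβ.ne']
  · have hpos : (0 : ℝ) < (#X : ℝ) ^ β :=
      Real.rpow_pos_of_pos (by exact_mod_cast hX.card_pos) _
    exact (div_le_iff₀ hpos).1 (hmax X (by simpa using hX))

open Finset in
/-- Every vertex set contains a subset of large minimum degree that retains most edges. -/
lemma exists_subset_le_degIn (G : SimpleGraph V) (S : Finset V) {δ : ℝ} (hδ : 0 ≤ δ) :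
    ∃ T ⊆ S, (∀ v ∈ T, δ ≤ degIn G T v) ∧
      (pairCount G S : ℝ) - 2 * δ * #S ≤ pairCount G T := by
  classical
  obtain ⟨T, hT, hmax⟩ := exists_max_image S.powerset
    (fun X => (pairCount G X : ℝ) - 2 * δ * #X) ⟨S, by simp⟩
  rw [mem_powerset] at hT
  refine ⟨T, hT, fun v hv => ?_, ?_⟩
  · have h1 := hmax (T.erase v) (mem_powerset.2 ((erase_subset v T).trans hT))
    have h2 : (pairCount G T : ℝ) ≤ pairCount G (T.erase v) + 2 * degIn G T v := by
      exact_mod_cast pairCount_le_erase G T v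
    have h3 : (#(T.erase v) : ℝ) + 1 = #T := by exact_mod_cast card_erase_add_one hv
    rw [← h3] at h1
    linarith
  · have h1 := hmax S (by simp)
    have : 0 ≤ 2 * δ * (#T : ℝ) := by positivity
    linarith

open Finset in
/-- If no vertex set is much denser than `S`, then deleting the vertices of `S` whose degree
exceeds `N` times the average destroys at most half of the edges inside `S`. -/
lemma exists_subset_degIn_le (G : SimpleGraph V) {S : Finset V} {N : ℕ} {γ : ℝ}
    (hγ0 : 0 < γ) (hγ1 : γ ≤ 1) (hN : N ≠ 0) (hNS : N ≤ #S) (hNγ : 18 ≤ (N : ℝ) ^ γ)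
    (hmax : ∀ X : Finset V,
      (pairCount G X : ℝ) ≤ pairCount G S / (#S : ℝ) ^ (1 + γ) * (#X : ℝ) ^ (1 + γ)) :
    ∃ R ⊆ S, (∀ v ∈ R, (degIn G S v : ℝ) ≤ N * pairCount G S / #S) ∧
      (pairCount G S : ℝ) / 2 ≤ pairCount G R := by
  classical
  set p : ℝ := (pairCount G S : ℝ) with hp
  have hp0 : 0 ≤ p := Nat.cast_nonneg _
  have hN0 : (0 : ℝ) < N := by exact_mod_cast Nat.pos_of_ne_zero hN
  have hNs : (N : ℝ) ≤ #S := by exact_mod_cast hNS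
  have hs0 : (0 : ℝ) < #S := hN0.trans_le hNs
  set A : Finset V := {v ∈ S | N * p / #S < degIn G S v} with hA
  refine ⟨S \ A, sdiff_subset, fun v hv => ?_, ?_⟩
  · simp only [hA, mem_sdiff, mem_filter, not_and, not_lt] at hv
    exact hv.2 hv.1
  rcases hp0.eq_or_lt with hp00 | hppos
  · rw [← hp00]; simp
  have hAcard : (#A : ℝ) ≤ #S / N := by
    have h1 : (#A : ℝ) * (N * p / #S) ≤ p := by
      rw [← nsmul_eq_mul, hp, pairCount, Nat.cast_sum]
      refine (card_nsmul_le_sum A (fun v => (degIn G S v : ℝ)) _ fun v hv => ?_).trans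
        (sum_le_sum_of_subset_of_nonneg (filter_subset _ _) fun _ _ _ => Nat.cast_nonneg _)
      have := (mem_filter.1 hv).2.le
      rwa [hp, pairCount, Nat.cast_sum] at this
    rw [le_div_iff₀ hN0]
    have h2 : (#A : ℝ) * (N * p / #S) = (#A * N) * p / #S := by ring
    rw [h2, div_le_iff₀ hs0, mul_comm p] at h1
    exact le_of_mul_le_mul_right h1 hppos
  obtain ⟨P, hP, hPN⟩ := Finpartition.exists_equipartition_card_eq S hN hNS
  have hpart : ∀ B ∈ P.parts,
      (pairCount G (A ∪ B) : ℝ) ≤ p / (#S : ℝ) ^ (1 + γ) * (3 * (#S / N)) ^ (1 + γ) := by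
    intro B hB
    refine (hmax _).trans (mul_le_mul_of_nonneg_left ?_ (by positivity))
    refine Real.rpow_le_rpow (by positivity) ?_ (by positivity)
    have h1 : (#B : ℝ) ≤ #S / N + 1 := by
      have := hP.card_part_le_average_add_one hB
      rw [hPN] at this
      calc (#B : ℝ) ≤ ((#S / N + 1 : ℕ) : ℝ) := by exact_mod_cast this
        _ ≤ #S / N + 1 := by
          push_cast
          gcongr
          exact Nat.cast_div_le
    have h2 : (#(A ∪ B) : ℝ) ≤ #A + #B := by exact_mod_cast card_union_le A B
    have h3 : (1 : ℝ) ≤ #S / N := by rwa [le_div_iff₀ hN0, one_mul]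
    linarith
  have hsum : (∑ B ∈ P.parts, (pairCount G (A ∪ B) : ℝ)) ≤ p / 2 := by
    refine (sum_le_card_nsmul _ _ _ hpart).trans ?_
    rw [hPN, nsmul_eq_mul, Real.mul_rpow (by norm_num) (by positivity),
      Real.div_rpow hs0.le hN0.le]
    have hsp : 0 < (#S : ℝ) ^ (1 + γ) := Real.rpow_pos_of_pos hs0 _
    have h9 : (3 : ℝ) ^ (1 + γ) ≤ 9 :=
      calc (3 : ℝ) ^ (1 + γ) ≤ 3 ^ (2 : ℝ) :=
            Real.rpow_le_rpow_of_exponent_le (by norm_num) (by linarith)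
        _ = 9 := by norm_num
    have hNg : (N : ℝ) ^ (1 + γ) = N * (N : ℝ) ^ γ := by
      rw [Real.rpow_add hN0, Real.rpow_one]
    have hNgp : 0 < (N : ℝ) ^ γ := by linarith
    rw [hNg]
    have : (N : ℝ) * (p / (#S : ℝ) ^ (1 + γ) *
        (3 ^ (1 + γ) * ((#S : ℝ) ^ (1 + γ) / (N * (N : ℝ) ^ γ)))) =
        p * 3 ^ (1 + γ) / (N : ℝ) ^ γ := by
      field_simp
    rw [this, div_le_iff₀ hNgp]
    nlinarith
  have hsplit : p ≤ pairCount G (S \ A) + ∑ B ∈ P.parts, (pairCount G (A ∪ B) : ℝ) := by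
    rw [hp]
    exact_mod_cast pairCount_le_sdiff_add_sum G A P
  linarith

/-- Erdős–Simonovits regularization: for every `0 < α < 1` there are `K = K(α)` and
`n₀ = n₀(α)` such that every graph with `n ≥ n₀` vertices and at least `n^{1+α}` edges
contains a `K`-almost-regular subgraph on `m ≥ n^{α(1-α)/(1+α)}` vertices with at least
`(2/5)·m^{1+α}` edges. -/
theorem erdos_simonovits_regularization (α : ℝ) (h0 : 0 < α) (h1 : α < 1) :
    ∃ (K : ℝ) (n₀ : ℕ), ∀ (V : Type) [Fintype V] (G : SimpleGraph V),
      n₀ ≤ Fintype.card V →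
      (Fintype.card V : ℝ) ^ (1 + α) ≤ (edgeCount G : ℝ) →
      ∃ H : G.Subgraph, SubAlmostRegular H K ∧
        (Fintype.card V : ℝ) ^ (α * (1 - α) / (1 + α)) ≤ (H.verts.ncard : ℝ) ∧
        (2 / 5 : ℝ) * (H.verts.ncard : ℝ) ^ (1 + α) ≤ (subEdgeCount H : ℝ) := by
  have hγ0 : 0 < α ^ 2 := by positivity
  have hγα : α ^ 2 < α := by nlinarith
  obtain ⟨N, hN0, hNγ⟩ : ∃ N : ℕ, N ≠ 0 ∧ 18 ≤ (N : ℝ) ^ (α ^ 2) :=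
    ((Filter.eventually_ne_atTop 0).and (((tendsto_rpow_atTop hγ0).comp
      tendsto_natCast_atTop_atTop).eventually_ge_atTop 18)).exists
  obtain ⟨n₀, hn₀⟩ : ∃ n₀ : ℕ, ∀ n : ℕ, n₀ ≤ n →
      n ≠ 0 ∧ 5 * N / 2 ≤ (n : ℝ) ^ (α ^ 2 / (1 + α)) :=
    Filter.eventually_atTop.1 ((Filter.eventually_ne_atTop 0).and
      (((tendsto_rpow_atTop (y := α ^ 2 / (1 + α)) (by positivity)).comp
      tendsto_natCast_atTop_atTop).eventually_ge_atTop (5 * N / 2 : ℝ)))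
  refine ⟨20 * N, n₀, fun V _ G hn hE => ?_⟩
  classical
  obtain ⟨hn0, hnN⟩ := hn₀ _ hn
  have : Nonempty V := Fintype.card_pos_iff.1 (Nat.pos_of_ne_zero hn0)
  set n : ℝ := (Fintype.card V : ℝ) with hn_def
  have hn1 : 1 ≤ n := Nat.one_le_cast.2 (Nat.one_le_iff_ne_zero.2 hn0)
  have hnpos : 0 < n := by linarith
  have hNpos : (0 : ℝ) < N := by exact_mod_cast Nat.pos_of_ne_zero hN0
  obtain ⟨S, hS, hmax⟩ := exists_max_pairCount_ratio G (β := 1 + α ^ 2) (by positivity)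
  set s : ℝ := (S.card : ℝ) with hs_def
  set p : ℝ := (pairCount G S : ℝ) with hp_def
  have hs1 : 1 ≤ s := Nat.one_le_cast.2 hS.card_pos
  have hspos : 0 < s := by linarith
  have hsn : s ≤ n := Nat.cast_le.2 S.card_le_univ
  have hspow : 0 < s ^ (1 + α ^ 2) := Real.rpow_pos_of_pos hspos _
  have hM : 2 * n ^ (α - α ^ 2) ≤ p / s ^ (1 + α ^ 2) := by
    have h1 := hmax Finset.univ
    rw [pairCount_univ, Finset.card_univ] at h1
    push_cast at h1
    have h2 : 2 * n ^ (α - α ^ 2) * n ^ (1 + α ^ 2) = 2 * n ^ (1 + α) := by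
      rw [mul_assoc, ← Real.rpow_add hnpos]
      ring_nf
    refine le_of_mul_le_mul_right ?_ (Real.rpow_pos_of_pos hnpos (1 + α ^ 2))
    linarith
  have hp : 2 * s ^ (1 + α) ≤ p := by
    have h1 : 2 * s ^ (α - α ^ 2) ≤ p / s ^ (1 + α ^ 2) :=
      le_trans (by gcongr) hM
    rw [le_div_iff₀ hspow, mul_assoc, ← Real.rpow_add hspos] at h1
    rwa [show α - α ^ 2 + (1 + α ^ 2) = 1 + α by ring] at h1
  have hppos : 0 < p := lt_of_lt_of_le (by positivity) hp
  have hs : n ^ (α / (1 + α)) ≤ s := by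
    have hps : p ≤ s ^ (2 : ℝ) := by
      rw [Real.rpow_two, hp_def, hs_def]
      exact_mod_cast pairCount_le_sq G S
    have h1 : n ^ (α - α ^ 2) ≤ s ^ (1 - α ^ 2) := by
      have h2 : p / s ^ (1 + α ^ 2) ≤ s ^ (1 - α ^ 2) := by
        rw [div_le_iff₀ hspow, ← Real.rpow_add hspos]
        rwa [show 1 - α ^ 2 + (1 + α ^ 2) = 2 by ring]
      have h3 : 0 ≤ n ^ (α - α ^ 2) := by positivity
      linarith
    have hpos : 0 < 1 - α ^ 2 := by linarith
    have h2 := Real.rpow_le_rpow (by positivity) h1 (inv_nonneg.2 hpos.le)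
    rw [← Real.rpow_mul hnpos.le, ← Real.rpow_mul hspos.le, mul_inv_cancel₀ hpos.ne',
      Real.rpow_one] at h2
    convert h2 using 2
    have h3 : 1 - α ≠ 0 := by linarith
    rw [← div_eq_mul_inv, div_eq_div_iff (by positivity) hpos.ne']
    ring
  have hsN : n ^ (α * (1 - α) / (1 + α)) * (5 * N / 2) ≤ s := by
    refine le_trans ?_ hs
    have h1 : n ^ (α / (1 + α)) = n ^ (α * (1 - α) / (1 + α)) * n ^ (α ^ 2 / (1 + α)) := by
      rw [← Real.rpow_add hnpos]
      congr 1
      field_simp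
      ring
    rw [h1]
    gcongr
  have hn1' : 1 ≤ n ^ (α * (1 - α) / (1 + α)) := Real.one_le_rpow hn1 <| by
    have : 0 < 1 - α := by linarith
    positivity
  have hNs : N ≤ S.card := by
    have : (N : ℝ) ≤ s := by nlinarith
    exact Nat.cast_le.1 this
  obtain ⟨R, hRS, hRdeg, hR⟩ :=
    exists_subset_degIn_le G hγ0 (by linarith) hN0 hNs hNγ hmax
  obtain ⟨T, hTR, hTdeg, hT⟩ := exists_subset_le_degIn G R (δ := p / (20 * s)) (by positivity)
  have hTS := hTR.trans hRS
  have hTmax : ∀ v ∈ T, (degIn G T v : ℝ) ≤ N * p / s := fun v hv =>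
    le_trans (by exact_mod_cast degIn_mono G hTS v) (hRdeg v (hTR hv))
  have hTcount : 2 / 5 * p ≤ pairCount G T := by
    have h1 : 2 * (p / (20 * s)) * R.card ≤ p / 10 :=
      calc 2 * (p / (20 * s)) * R.card ≤ 2 * (p / (20 * s)) * s := by
            gcongr
            exact Nat.cast_le.2 (Finset.card_le_card hRS)
        _ = p / 10 := by field_simp; norm_num
    linarith
  have hTs : (T.card : ℝ) ≤ s := Nat.cast_le.2 (Finset.card_le_card hTS)
  refine ⟨(⊤ : G.Subgraph).induce (T : Set V), ?_, ?_, ?_⟩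
  · intro v hv w hw
    have hv : v ∈ T := by simpa using hv
    have hw : w ∈ T := by simpa using hw
    rw [subDeg_induce_top G hv, subDeg_induce_top G hw]
    calc (degIn G T v : ℝ) ≤ N * p / s := hTmax v hv
      _ = 20 * N * (p / (20 * s)) := by field_simp
      _ ≤ 20 * N * degIn G T w := by gcongr; exact hTdeg w hw
  · rw [SimpleGraph.Subgraph.induce_verts, Set.ncard_coe_finset]
    have h1 : 2 / 5 * p ≤ T.card * (N * p / s) := by
      refine hTcount.trans ?_
      rw [pairCount, Nat.cast_sum, ← nsmul_eq_mul]
      exact Finset.sum_le_card_nsmul _ _ _ hTmax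
    have h2 : (T.card : ℝ) * (N * p / s) = T.card * N * p / s := by ring
    rw [h2, le_div_iff₀ hspos] at h1
    have h3 : 2 / 5 * s ≤ T.card * N := by
      refine le_of_mul_le_mul_right ?_ hppos
      linarith
    refine le_of_mul_le_mul_right ?_ hNpos
    linarith
  · rw [SimpleGraph.Subgraph.induce_verts, Set.ncard_coe_finset]
    have h1 : (pairCount G T : ℝ) = 2 * subEdgeCount ((⊤ : G.Subgraph).induce (T : Set V)) := by
      exact_mod_cast pairCount_eq_two_mul_subEdgeCount G T
    have h2 : (T.card : ℝ) ^ (1 + α) ≤ s ^ (1 + α) := by gcongr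
    linarith
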